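/- Suppose α ≥ 1 and n ≥ 2. Then W_α is an eigenvector of the Markov chain M_α with eigenvalue 1 − 2/n: for every partition λ of n, Σ_{ρ partition of n} M_α(λ,ρ)·W_α(ρ) = (1 − 2/n)·W_α(λ). -/

import Mathlib

open Finset

namespace JackTest

def colLen {n : ℕ} (lam : n.Partition) (j : ℕ) : ℕ :=
  (lam.parts.filter (fun p => j < p)).card

def rowLen {n : ℕ} (lam : n.Partition) (i : ℕ) : ℕ :=
  ((Finset.range n).filter (fun j => i < colLen lam j)).card

def cells {n : ℕ} (lam : n.Partition) : Finset (ℕ × ℕ) :=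
  (Finset.range n ×ˢ Finset.range n).filter (fun s => s.2 < rowLen lam s.1)

def arm {n : ℕ} (lam : n.Partition) (s : ℕ × ℕ) : ℕ := rowLen lam s.1 - (s.2 + 1)

def leg {n : ℕ} (lam : n.Partition) (s : ℕ × ℕ) : ℕ := colLen lam s.2 - (s.1 + 1)

noncomputable def cLow (α : ℝ) {n : ℕ} (lam : n.Partition) : ℝ :=
  ∏ s ∈ cells lam, (α * arm lam s + leg lam s + 1)

noncomputable def cUp (α : ℝ) {n : ℕ} (lam : n.Partition) : ℝ :=
  ∏ s ∈ cells lam, (α * arm lam s + leg lam s + α)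

noncomputable def jackP (α : ℝ) {n : ℕ} (lam : n.Partition) : ℝ :=
  α ^ n * (n.factorial) / (cLow α lam * cUp α lam)

def nStat {n : ℕ} (lam : n.Partition) : ℕ := ∑ i ∈ Finset.range n, i * rowLen lam i

def nStatConj {n : ℕ} (lam : n.Partition) : ℕ := ∑ j ∈ Finset.range n, j * colLen lam j

noncomputable def W (α : ℝ) {n : ℕ} (lam : n.Partition) : ℝ :=
  (α * nStatConj lam - nStat lam) / Real.sqrt (α * n.choose 2)

noncomputable def Phi (x : ℝ) : ℝ :=
  (Real.sqrt (2 * Real.pi))⁻¹ * ∫ t in Set.Iic x, Real.exp (-t ^ 2 / 2)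

/-- `ψ'_{λ/τ}(α)`: zero unless `τ ⊆ λ` (the sizes `|λ| = |τ| + 1` are enforced by the types);
otherwise the product over boxes in the columns of `λ` meeting `λ - τ` but not in the rows
of `λ` meeting `λ - τ`. -/
noncomputable def psi' (α : ℝ) {n : ℕ} (lam : n.Partition) (tau : (n - 1).Partition) : ℝ :=
  if cells tau ⊆ cells lam then
    ∏ s ∈ ((cells lam).filter fun s => ∃ t ∈ cells lam \ cells tau, s.2 = t.2) \
        ((cells lam).filter fun s => ∃ t ∈ cells lam \ cells tau, s.1 = t.1),
      (α * arm lam s + leg lam s + 1) / (α * arm lam s + leg lam s + α) *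
        ((α * arm tau s + leg tau s + α) / (α * arm tau s + leg tau s + 1))
  else 0

/-- The Markov chain `M_α` on partitions of `n`. -/
noncomputable def M (α : ℝ) {n : ℕ} (lam rho : n.Partition) : ℝ :=
  cUp α lam / (α * n * cLow α rho) *
    ∑ tau : (n - 1).Partition, psi' α lam tau * psi' α rho tau * cLow α tau / cUp α tau


section NodeWeights

/-- The residue weight at the node `a i` of the rational function `∏ j < N, (1 + ε / (z - a j))`,
up to the factor `ε`. -/
noncomputable def nodeWeight (ε : ℝ) (a : ℕ → ℝ) (N i : ℕ) : ℝ :=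
  ∏ j ∈ (range N).erase i, (1 + ε / (a i - a j))

lemma nodeWeight_succ_of_lt (ε : ℝ) (a : ℕ → ℝ) {N i : ℕ} (hi : i < N) :
    nodeWeight ε a (N + 1) i = nodeWeight ε a N i * (1 + ε / (a i - a N)) := by
  unfold nodeWeight
  rw [range_add_one, erase_insert_of_ne (by omega), prod_insert (by simp), mul_comm]

lemma nodeWeight_succ_self (ε : ℝ) (a : ℕ → ℝ) (N : ℕ) :
    nodeWeight ε a (N + 1) N = ∏ j ∈ range N, (1 + ε / (a N - a j)) := by
  unfold nodeWeight
  rw [range_add_one, erase_insert (by simp)]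

lemma prod_one_add_div (ε : ℝ) {a : ℕ → ℝ} (ha : Function.Injective a) (N : ℕ) {z : ℝ}
    (hz : ∀ j < N, z ≠ a j) :
    ∏ j ∈ range N, (1 + ε / (z - a j)) =
      1 + ∑ i ∈ range N, ε * nodeWeight ε a N i / (z - a i) := by
  induction N generalizing z with
  | zero => simp
  | succ N ih =>
    have hlt : ∀ j < N, a N ≠ a j := fun j hj h => by have := ha h; omega
    have hzN := sub_ne_zero.mpr (hz N (by omega))
    rw [prod_range_succ, sum_range_succ, nodeWeight_succ_self, ih hlt,
      ih (fun j hj => hz j (by omega))]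
    have key : ∀ i ∈ range N, ε * nodeWeight ε a (N + 1) i / (z - a i) =
        ε * nodeWeight ε a N i / (z - a i) * (1 + ε / (z - a N)) -
          ε * nodeWeight ε a N i / (a N - a i) * (ε / (z - a N)) := by
      intro i hi
      rw [mem_range] at hi
      have h1 := sub_ne_zero.mpr (hz i (by omega))
      have h2 := sub_ne_zero.mpr (hlt i hi)
      have h3 := sub_ne_zero.mpr (hlt i hi).symm
      rw [nodeWeight_succ_of_lt ε a hi]
      field_simp
      ring
    rw [sum_congr rfl key, sum_sub_distrib, ← sum_mul, ← sum_mul]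
    ring

lemma sum_nodeWeight_succ (ε : ℝ) {a : ℕ → ℝ} (ha : Function.Injective a) (N : ℕ) (p : ℝ → ℝ) :
    ∑ i ∈ range (N + 1), nodeWeight ε a (N + 1) i * p (a i) =
      ∑ i ∈ range N, nodeWeight ε a N i * p (a i) + p (a N) +
        ε * ∑ i ∈ range N, nodeWeight ε a N i * ((p (a i) - p (a N)) / (a i - a N)) := by
  have hlt : ∀ j < N, a N ≠ a j := fun j hj h => by have := ha h; omega
  have key : ∀ i ∈ range N, nodeWeight ε a (N + 1) i * p (a i) =
      nodeWeight ε a N i * p (a i) +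
        ε * (nodeWeight ε a N i * ((p (a i) - p (a N)) / (a i - a N))) -
          ε * nodeWeight ε a N i / (a N - a i) * p (a N) := by
    intro i hi
    rw [mem_range] at hi
    have h2 := sub_ne_zero.mpr (hlt i hi)
    have h3 := sub_ne_zero.mpr (hlt i hi).symm
    rw [nodeWeight_succ_of_lt ε a hi]
    field_simp
    ring
  rw [sum_range_succ, nodeWeight_succ_self, prod_one_add_div ε ha N hlt, sum_congr rfl key,
    sum_sub_distrib, sum_add_distrib, ← mul_sum, ← sum_mul]
  ring

lemma sum_nodeWeight (ε : ℝ) {a : ℕ → ℝ} (ha : Function.Injective a) (N : ℕ) :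
    ∑ i ∈ range N, nodeWeight ε a N i = N := by
  induction N with
  | zero => simp
  | succ N ih => simpa [ih] using sum_nodeWeight_succ ε ha N fun _ => 1

lemma sum_nodeWeight_mul_succ (ε : ℝ) {a : ℕ → ℝ} (ha : Function.Injective a) (N : ℕ) :
    ∑ i ∈ range (N + 1), nodeWeight ε a (N + 1) i * a i =
      ∑ i ∈ range N, nodeWeight ε a N i * a i + a N + ε * N := by
  rw [sum_nodeWeight_succ ε ha N fun x => x, ← sum_nodeWeight ε ha N]
  congr 2
  refine sum_congr rfl fun i hi => ?_
  rw [div_self, mul_one]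
  exact sub_ne_zero.mpr fun h => by have := ha h; simp at hi; omega

lemma sum_nodeWeight_mul_sq_succ (ε : ℝ) {a : ℕ → ℝ} (ha : Function.Injective a) (N : ℕ) :
    ∑ i ∈ range (N + 1), nodeWeight ε a (N + 1) i * a i ^ 2 =
      ∑ i ∈ range N, nodeWeight ε a N i * a i ^ 2 + a N ^ 2 +
        ε * (∑ i ∈ range N, nodeWeight ε a N i * a i + N * a N) := by
  rw [sum_nodeWeight_succ ε ha N fun x => x ^ 2, ← sum_nodeWeight ε ha N, sum_mul,
    ← sum_add_distrib]
  congr 2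
  refine sum_congr rfl fun i hi => ?_
  have : a i - a N ≠ 0 := sub_ne_zero.mpr fun h => by have := ha h; simp at hi; omega
  field_simp
  ring

end NodeWeights

section Multisets

lemma lt_card_filter_range_iff {n : ℕ} {P : ℕ → Prop} [DecidablePred P]
    (hP : ∀ j k, j ≤ k → P k → P j) (hn : ∀ j, P j → j < n) (j : ℕ) :
    j < ((range n).filter P).card ↔ P j := by
  constructor
  · intro h
    by_contra hj
    have : (range n).filter P ⊆ range j := by
      intro k hk
      rw [mem_filter] at hk
      rw [mem_range]
      by_contra hkj
      exact hj (hP j k (by omega) hk.2)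
    have := card_le_card this
    simp at this
    omega
  · intro h
    have : range (j + 1) ⊆ (range n).filter P := by
      intro k hk
      rw [mem_range] at hk
      rw [mem_filter, mem_range]
      have := hP k j (by omega) h
      exact ⟨hn k this, this⟩
    have := card_le_card this
    simp at this
    omega

lemma card_filter_lt_eq_add_count (s : Multiset ℕ) (j : ℕ) :
    (s.filter (fun p => j < p)).card = (s.filter (fun p => j + 1 < p)).card + s.count (j + 1) := by
  induction s using Multiset.induction_on with
  | empty => simp
  | cons p s ih =>
    simp only [← Multiset.countP_eq_card_filter, Multiset.countP_cons, Multiset.count_cons] at ih ⊢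
    split_ifs <;> omega

lemma sum_card_filter_lt (s : Multiset ℕ) (n : ℕ) (hs : ∀ p ∈ s, p ≤ n) :
    ∑ j ∈ range n, (s.filter (fun p => j < p)).card = s.sum := by
  induction s using Multiset.induction_on with
  | empty => simp
  | cons p s ih =>
    have hp := hs p (by simp)
    simp only [← Multiset.countP_eq_card_filter, Multiset.countP_cons] at ih ⊢
    rw [sum_add_distrib, ih fun q hq => hs q (by simp [hq]), ← card_filter, Multiset.sum_cons,
      add_comm]
    congr 1
    have : (range n).filter (fun j => j < p) = range p := by
      ext j; simp; omega
    rw [this, card_range]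

end Multisets

section RowsAndColumns

variable {n : ℕ} (lam : n.Partition)

lemma colLen_antitone : Antitone (colLen lam) := fun _ _ h =>
  Multiset.card_le_card (Multiset.monotone_filter_right _ fun _ hp => lt_of_le_of_lt h hp)

lemma colLen_eq_zero {j : ℕ} (h : n ≤ j) : colLen lam j = 0 := by
  rw [colLen, Multiset.card_eq_zero, Multiset.filter_eq_nil]
  intro p hp
  have := Nat.Partition.le_of_mem_parts hp
  omega

lemma colLen_le (j : ℕ) : colLen lam j ≤ n := by
  calc colLen lam j ≤ lam.parts.card := Multiset.card_le_card (Multiset.filter_le _ _)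
    _ = lam.parts.card • 1 := by simp
    _ ≤ lam.parts.sum := Multiset.card_nsmul_le_sum fun p hp => lam.parts_pos hp
    _ = n := lam.parts_sum

lemma lt_rowLen_iff {i j : ℕ} : j < rowLen lam i ↔ i < colLen lam j := by
  refine lt_card_filter_range_iff (P := fun j => i < colLen lam j)
    (fun j k h hk => lt_of_lt_of_le hk (colLen_antitone lam h)) (fun j hj => ?_) j
  by_contra h
  rw [colLen_eq_zero lam (by omega)] at hj
  omega

lemma rowLen_eq_zero {i : ℕ} (h : n ≤ i) : rowLen lam i = 0 := by
  by_contra h0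
  have := (lt_rowLen_iff lam).1 (Nat.pos_of_ne_zero h0)
  have := colLen_le lam 0
  omega

lemma rowLen_antitone : Antitone (rowLen lam) := by
  intro i k h
  by_contra! hlt
  have := (lt_rowLen_iff lam).1 hlt
  have := mt (lt_rowLen_iff lam).2 (lt_irrefl (rowLen lam i))
  omega

lemma rowLen_le (i : ℕ) : rowLen lam i ≤ n := by
  by_contra! h
  have := (lt_rowLen_iff lam).1 h
  rw [colLen_eq_zero lam le_rfl] at this
  omega

lemma mem_cells_iff {s : ℕ × ℕ} : s ∈ cells lam ↔ s.2 < rowLen lam s.1 := by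
  simp only [cells, mem_filter, mem_product, mem_range, and_iff_right_iff_imp]
  intro h
  refine ⟨?_, h.trans_le (rowLen_le lam _)⟩
  by_contra hs
  rw [rowLen_eq_zero lam (by omega)] at h
  omega

lemma sum_sum_range_rowLen (φ : ℕ → ℕ) :
    ∑ i ∈ range n, ∑ j ∈ range (rowLen lam i), φ j = ∑ j ∈ range n, φ j * colLen lam j := by
  have h1 : ∀ i, range (rowLen lam i) = (range n).filter fun j => j < rowLen lam i := by
    intro i
    ext j
    have := rowLen_le lam i
    simp
    omega
  have h2 : ∀ j, (range n).filter (fun i => j < rowLen lam i) = range (colLen lam j) := by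
    intro j
    ext i
    have := colLen_le lam j
    simp only [mem_filter, mem_range, lt_rowLen_iff]
    omega
  simp only [h1, sum_filter]
  rw [sum_comm]
  refine sum_congr rfl fun j _ => ?_
  rw [← sum_filter, h2, sum_const, card_range, smul_eq_mul, mul_comm]

lemma sum_rowLen : ∑ i ∈ range n, rowLen lam i = n := by
  have := sum_sum_range_rowLen lam fun _ => 1
  simp only [sum_const, card_range, smul_eq_mul, mul_one, one_mul] at this
  rw [this]
  exact (sum_card_filter_lt lam.parts n fun p hp => Nat.Partition.le_of_mem_parts hp).trans lam.parts_sum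

lemma nStatConj_eq : nStatConj lam = ∑ i ∈ range n, (rowLen lam i).choose 2 := by
  rw [nStatConj, ← sum_sum_range_rowLen lam fun j => j]
  exact sum_congr rfl fun i _ => by rw [sum_range_id, Nat.choose_two_right]

variable {lam}

lemma rowLen_injective {mu : n.Partition} (h : ∀ i, rowLen lam i = rowLen mu i) : lam = mu := by
  have hc : ∀ j, colLen lam j = colLen mu j := by
    intro j
    refine eq_of_forall_lt_iff fun i => ?_
    rw [← lt_rowLen_iff, ← lt_rowLen_iff, h]
  refine Nat.Partition.ext (Multiset.ext.2 fun p => ?_)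
  rcases p with _ | p
  · rw [Multiset.count_eq_zero_of_notMem fun h => lt_irrefl _ (lam.parts_pos h),
      Multiset.count_eq_zero_of_notMem fun h => lt_irrefl _ (mu.parts_pos h)]
  · have h1 := card_filter_lt_eq_add_count lam.parts p
    have h2 := card_filter_lt_eq_add_count mu.parts p
    have h3 := hc p
    have h4 := hc (p + 1)
    unfold colLen at h3 h4
    omega

lemma exists_partition_of_rows {N : ℕ} {f : ℕ → ℕ} (hf : Antitone f) (h0 : ∀ i, N ≤ i → f i = 0)
    (hsum : ∑ i ∈ range N, f i = n) : ∃ mu : n.Partition, ∀ i, rowLen mu i = f i := by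
  refine ⟨Nat.Partition.ofSums n ((range N).val.map f) hsum, fun i => ?_⟩
  refine eq_of_forall_lt_iff fun j => ?_
  rw [lt_rowLen_iff]
  have : colLen (Nat.Partition.ofSums n ((range N).val.map f) hsum) j =
      ((range N).filter fun i => j < f i).card := by
    change (Multiset.filter _ (Multiset.filter (· ≠ 0) (Multiset.map f (range N).val))).card = _
    rw [Multiset.filter_filter, Multiset.filter_map,
      Multiset.card_map, card_def, filter_val]
    congr 1
    refine Multiset.filter_congr fun k _ => ?_
    simp only [Function.comp]
    omega
  rw [this]
  refine lt_card_filter_range_iff (P := fun i => j < f i)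
    (fun a b hab hb => lt_of_lt_of_le hb (hf hab)) (fun k hk => ?_) i
  by_contra h
  have := h0 k (by omega)
  omega

end RowsAndColumns

section Telescoping

lemma prod_range_sub_div {α B : ℝ} (hα : 0 < α) {c : ℕ} (hB : 0 < B - α * c) :
    ∏ k ∈ range c, (B - α * (k + 1)) / (B - α * k) = (B - α * c) / B := by
  induction c with
  | zero =>
    have : B ≠ 0 := by simpa using hB.ne'
    simp [this]
  | succ c ih =>
    push_cast at hB ⊢
    have h : 0 < B - α * c := by linarith
    have h0 : 0 < B := by nlinarith [(Nat.cast_nonneg c : (0 : ℝ) ≤ c)]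
    rw [prod_range_succ, ih h]
    field_simp

/-- The linear form `A - α * x + y` telescopes along the boundary of a Young diagram,
from the point `(0, N)` to the point `(c, r + 1)`. -/
lemma prod_boundary {row col : ℕ → ℕ} (hdual : ∀ i j, j < row i ↔ i < col j) {α A : ℝ}
    (hα : 0 < α) {c r N : ℕ} (hrow : ∀ j, r < j → row j ≤ c) (hcol : ∀ k < c, r < col k)
    (hA : 0 < A - α * c + (r + 1)) (hN : r + 1 ≤ N) :
    (∏ k ∈ range c, (A - α * (k + 1) + (min (col k) N : ℕ)) / (A - α * k + (min (col k) N : ℕ))) *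
      ∏ j ∈ Ico (r + 1) N, (A - α * row j + j) / (A - α * row j + (j + 1)) =
      (A - α * c + (r + 1)) / (A + N) := by
  have hpos : ∀ k y : ℕ, k ≤ c → r + 1 ≤ y → 0 < A + y - α * k := by
    intro k y hk hy
    have h1 : (k : ℝ) ≤ c := by exact_mod_cast hk
    have h2 : (r + 1 : ℝ) ≤ y := by exact_mod_cast hy
    nlinarith
  induction N, hN using Nat.le_induction with
  | base =>
    have : ∀ k ∈ range c, (A - α * (k + 1) + (min (col k) (r + 1) : ℕ)) /
        (A - α * k + (min (col k) (r + 1) : ℕ)) =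
        ((A + (r + 1 : ℕ)) - α * (k + 1)) / ((A + (r + 1 : ℕ)) - α * k) := by
      intro k hk
      rw [min_eq_right (hcol k (mem_range.1 hk))]
      congr 1 <;> ring
    rw [prod_congr rfl this, prod_range_sub_div hα (hpos c _ le_rfl le_rfl)]
    simp only [Ico_self, prod_empty]
    push_cast
    ring
  | succ N hN ih =>
    have hNc : row N ≤ c := hrow N (by omega)
    have key : ∀ k ∈ range c, (A - α * (k + 1) + (min (col k) (N + 1) : ℕ)) /
        (A - α * k + (min (col k) (N + 1) : ℕ)) =
        (A - α * (k + 1) + (min (col k) N : ℕ)) / (A - α * k + (min (col k) N : ℕ)) *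
          (if k < row N then (((A + (N + 1 : ℕ)) - α * (k + 1)) / ((A + (N + 1 : ℕ)) - α * k)) /
            (((A + N) - α * (k + 1)) / ((A + N) - α * k)) else 1) := by
      intro k hk
      rw [mem_range] at hk
      split_ifs with h
      · have h' := (hdual _ _).1 h
        rw [min_eq_right (by omega : N + 1 ≤ col k), min_eq_right (by omega : N ≤ col k)]
        have h1 := hpos k N hk.le hN
        have h2 := hpos (k + 1) N hk hN
        have h3 := hpos k (N + 1) hk.le (by omega)
        push_cast at h1 h2 h3 ⊢
        have e1 : A - α * (k + 1) + N = A + N - α * (k + 1) := by ring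
        have e2 : A - α * k + N = A + N - α * k := by ring
        have e3 : A - α * (k + 1) + (N + 1) = A + (N + 1) - α * (k + 1) := by ring
        have e4 : A - α * k + (N + 1) = A + (N + 1) - α * k := by ring
        rw [e1, e2, e3, e4]
        field_simp
      · have h' := mt (hdual _ _).2 h
        rw [min_eq_left (by omega : col k ≤ N + 1), min_eq_left (by omega : col k ≤ N), mul_one]
    have hfil : (range c).filter (fun k => k < row N) = range (row N) := by
      ext k
      simp
      omega
    have htel := prod_div_distrib
      (fun k : ℕ => ((A + (N + 1 : ℕ)) - α * (k + 1)) / ((A + (N + 1 : ℕ)) - α * k))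
      (fun k : ℕ => ((A + N) - α * (k + 1)) / ((A + N) - α * k)) (s := range (row N))
    rw [prod_range_sub_div hα (hpos _ _ hNc (by omega)),
      prod_range_sub_div hα (hpos _ _ hNc hN)] at htel
    rw [prod_congr rfl key, prod_mul_distrib, ← prod_filter, hfil, htel, prod_Ico_succ_top hN]
    have h1 := hpos _ _ hNc hN
    have h2 := hpos _ (N + 1) hNc (by omega)
    have h3 := hpos 0 N (by omega) hN
    have h4 := hpos 0 (N + 1) (by omega) (by omega)
    push_cast at h1 h2 h3 h4 ih ⊢
    simp only [mul_zero, sub_zero] at h3 h4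
    have e1 : A - α * row N + N = A + N - α * row N := by ring
    have e2 : A - α * row N + (N + 1) = A + (N + 1) - α * row N := by ring
    rw [e1, e2, mul_mul_mul_comm, ih]
    field_simp

end Telescoping

section AddingABox

/-- The diagram of `rho` arises from that of `tau` by adding a box at the end of row `r`. -/
def AddsBox {m n : ℕ} (tau : m.Partition) (rho : n.Partition) (r : ℕ) : Prop :=
  ∀ i, rowLen rho i = rowLen tau i + if i = r then 1 else 0

variable {m n : ℕ} {tau : m.Partition} {rho : n.Partition} {r : ℕ}

lemma AddsBox.rowLen_self (h : AddsBox tau rho r) : rowLen rho r = rowLen tau r + 1 := by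
  simp [h r]

lemma AddsBox.rowLen_of_ne (h : AddsBox tau rho r) {i : ℕ} (hi : i ≠ r) :
    rowLen rho i = rowLen tau i := by
  simp [h i, hi]

lemma AddsBox.lt_rowLen (h : AddsBox tau rho r) {i : ℕ} (hi : i < r) :
    rowLen tau r < rowLen tau i := by
  have := rowLen_antitone rho hi.le
  rw [h.rowLen_self, h.rowLen_of_ne hi.ne] at this
  omega

lemma AddsBox.colLen_self (h : AddsBox tau rho r) : colLen tau (rowLen tau r) = r := by
  refine eq_of_forall_lt_iff fun i => ?_
  rw [← lt_rowLen_iff]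
  constructor
  · intro hi
    by_contra! hri
    have := rowLen_antitone tau hri
    omega
  · exact h.lt_rowLen

lemma AddsBox.colLen_eq (h : AddsBox tau rho r) (k : ℕ) :
    colLen rho k = colLen tau k + if k = rowLen tau r then 1 else 0 := by
  refine eq_of_forall_lt_iff fun i => ?_
  rw [← lt_rowLen_iff, h i]
  split_ifs with hi hk hk
  · subst hi hk
    simp [h.colLen_self]
  · have := lt_rowLen_iff tau (i := i) (j := k)
    subst hi
    omega
  · subst hk
    have := lt_rowLen_iff tau (i := i) (j := rowLen tau r)
    rw [h.colLen_self] at this ⊢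
    omega
  · exact lt_rowLen_iff tau

lemma AddsBox.cells_eq (h : AddsBox tau rho r) :
    cells rho = insert (r, rowLen tau r) (cells tau) := by
  ext ⟨i, j⟩
  rw [mem_insert, mem_cells_iff, mem_cells_iff, h i, Prod.mk.injEq]
  dsimp only
  split_ifs with hi
  · subst hi
    omega
  · omega

lemma AddsBox.notMem_cells : (r, rowLen tau r) ∉ cells tau := by
  simp [mem_cells_iff]

lemma AddsBox.sdiff_cells (h : AddsBox tau rho r) :
    cells rho \ cells tau = {(r, rowLen tau r)} := by
  rw [h.cells_eq, insert_sdiff_of_notMem _ AddsBox.notMem_cells, sdiff_self]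
  rfl

lemma AddsBox.row_lt (h : AddsBox tau rho r) : r < n := by
  by_contra! hr
  have := h.rowLen_self
  rw [rowLen_eq_zero rho hr] at this
  omega

/-- The factor of the box `s` in `cLow` (for `β = 1`) and `cUp` (for `β = α`). -/
noncomputable def boxFactor (α β : ℝ) {n : ℕ} (lam : n.Partition) (s : ℕ × ℕ) : ℝ :=
  α * arm lam s + leg lam s + β

lemma boxFactor_pos {α β : ℝ} (hα : 0 < α) (hβ : 0 < β) {n : ℕ} (lam : n.Partition)
    (s : ℕ × ℕ) : 0 < boxFactor α β lam s := by
  unfold boxFactor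
  positivity

lemma prod_boxFactor_pos {α β : ℝ} (hα : 0 < α) (hβ : 0 < β) {n : ℕ} (lam : n.Partition) :
    0 < ∏ s ∈ cells lam, boxFactor α β lam s :=
  prod_pos fun s _ => boxFactor_pos hα hβ lam s

lemma AddsBox.boxFactor_self (h : AddsBox tau rho r) (α β : ℝ) :
    boxFactor α β rho (r, rowLen tau r) = β := by
  simp [boxFactor, arm, leg, h.rowLen_self, h.colLen_eq, h.colLen_self]

lemma AddsBox.boxFactor_old_row {k : ℕ} (hk : k < rowLen tau r) (α β : ℝ) :
    boxFactor α β tau (r, k) = α * (rowLen tau r - k - 1) + (colLen tau k - r - 1) + β := by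
  have := (lt_rowLen_iff tau).1 hk
  simp only [boxFactor, arm, leg]
  rw [Nat.cast_sub (by omega), Nat.cast_sub (by omega)]
  push_cast
  ring

lemma AddsBox.boxFactor_new_row (h : AddsBox tau rho r) {k : ℕ} (hk : k < rowLen tau r)
    (α β : ℝ) :
    boxFactor α β rho (r, k) = α * (rowLen tau r - k) + (colLen tau k - r - 1) + β := by
  have := (lt_rowLen_iff tau).1 hk
  simp only [boxFactor, arm, leg, h.rowLen_self, h.colLen_eq, if_neg hk.ne, add_zero]
  rw [Nat.cast_sub (by omega), Nat.cast_sub (by omega)]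
  push_cast
  ring

lemma AddsBox.boxFactor_old_col (h : AddsBox tau rho r) {i : ℕ} (hi : i < r) (α β : ℝ) :
    boxFactor α β tau (i, rowLen tau r) =
      α * (rowLen tau i - rowLen tau r - 1) + (r - i - 1) + β := by
  have := h.lt_rowLen hi
  simp only [boxFactor, arm, leg, h.colLen_self]
  rw [Nat.cast_sub (by omega), Nat.cast_sub (by omega)]
  push_cast
  ring

lemma AddsBox.boxFactor_new_col (h : AddsBox tau rho r) {i : ℕ} (hi : i < r) (α β : ℝ) :
    boxFactor α β rho (i, rowLen tau r) =
      α * (rowLen tau i - rowLen tau r - 1) + (r - i) + β := by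
  have := h.lt_rowLen hi
  simp only [boxFactor, arm, leg, h.colLen_eq, h.colLen_self, h.rowLen_of_ne hi.ne, if_true]
  rw [Nat.cast_sub (by omega), Nat.cast_sub (by omega)]
  push_cast
  ring

lemma AddsBox.prod_boxFactor (h : AddsBox tau rho r) {α β : ℝ} (hα : 0 < α) (hβ : 0 < β) :
    ∏ s ∈ cells rho, boxFactor α β rho s = β * (∏ s ∈ cells tau, boxFactor α β tau s) *
      ((∏ k ∈ range (rowLen tau r), boxFactor α β rho (r, k) / boxFactor α β tau (r, k)) *
        ∏ i ∈ range r, boxFactor α β rho (i, rowLen tau r) /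
          boxFactor α β tau (i, rowLen tau r)) := by
  have hratio : ∏ s ∈ cells tau, boxFactor α β rho s =
      (∏ s ∈ cells tau, boxFactor α β tau s) *
        ∏ s ∈ cells tau, boxFactor α β rho s / boxFactor α β tau s := by
    rw [← prod_mul_distrib]
    exact prod_congr rfl fun s _ => (mul_div_cancel₀ _ (boxFactor_pos hα hβ tau s).ne').symm
  rw [h.cells_eq, prod_insert AddsBox.notMem_cells, h.boxFactor_self, hratio, mul_assoc]
  congr 2
  have hdisj : Disjoint ((range (rowLen tau r)).image fun k => (r, k))
      ((range r).image fun i => (i, rowLen tau r)) := by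
    rw [disjoint_left]
    intro s hs hs'
    simp only [mem_image, mem_range] at hs hs'
    obtain ⟨k, hk, rfl⟩ := hs
    obtain ⟨i, hi, hik⟩ := hs'
    simp at hik
    omega
  rw [← prod_image (f := fun s => boxFactor α β rho s / boxFactor α β tau s)
      (g := fun k => (r, k)) (fun x _ y _ hxy => by simpa using hxy),
    ← prod_image (f := fun s => boxFactor α β rho s / boxFactor α β tau s)
      (g := fun i => (i, rowLen tau r)) (fun x _ y _ hxy => by simpa using hxy),
    ← prod_union hdisj]
  symm
  refine prod_subset ?_ ?_
  · intro s hs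
    rw [mem_union, mem_image, mem_image] at hs
    rw [mem_cells_iff]
    rcases hs with ⟨k, hk, rfl⟩ | ⟨i, hi, rfl⟩
    · exact mem_range.1 hk
    · exact h.lt_rowLen (mem_range.1 hi)
  · rintro ⟨i, j⟩ hs hs'
    rw [mem_cells_iff] at hs
    dsimp only at hs
    have hi : i ≠ r := by
      rintro rfl
      exact hs' (mem_union_left _ (mem_image_of_mem _ (mem_range.2 hs)))
    have hj : j ≠ rowLen tau r := by
      rintro rfl
      have := (lt_rowLen_iff tau).1 hs
      rw [h.colLen_self] at this
      exact hs' (mem_union_right _ (mem_image_of_mem _ (mem_range.2 this)))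
    have : boxFactor α β rho (i, j) = boxFactor α β tau (i, j) := by
      simp [boxFactor, arm, leg, h.rowLen_of_ne hi, h.colLen_eq, hj]
    rw [this, div_self (boxFactor_pos hα hβ tau _).ne']

lemma AddsBox.psi'_eq {tau : (n - 1).Partition} (h : AddsBox tau rho r) (α : ℝ) :
    psi' α rho tau = ∏ i ∈ range r,
      boxFactor α 1 rho (i, rowLen tau r) / boxFactor α α rho (i, rowLen tau r) *
        (boxFactor α α tau (i, rowLen tau r) / boxFactor α 1 tau (i, rowLen tau r)) := by
  have hsub : cells tau ⊆ cells rho := by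
    rw [h.cells_eq]
    exact subset_insert _ _
  rw [psi', if_pos hsub, h.sdiff_cells]
  have hset : ((cells rho).filter fun s => ∃ t ∈ ({(r, rowLen tau r)} : Finset (ℕ × ℕ)),
      s.2 = t.2) \ ((cells rho).filter fun s => ∃ t ∈ ({(r, rowLen tau r)} : Finset (ℕ × ℕ)),
      s.1 = t.1) = (range r).image fun i => (i, rowLen tau r) := by
    ext ⟨i, j⟩
    simp only [mem_sdiff, mem_filter, mem_singleton, exists_eq_left, mem_image, mem_range,
      Prod.mk.injEq, mem_cells_iff]
    have h1 := lt_rowLen_iff rho (i := i) (j := j)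
    constructor
    · rintro ⟨⟨h2, rfl⟩, h3⟩
      rw [h1, h.colLen_eq, h.colLen_self, if_pos rfl] at h2
      refine ⟨i, ?_, rfl, rfl⟩
      by_contra hir
      exact h3 ⟨h1.2 (by rw [h.colLen_eq, h.colLen_self, if_pos rfl]; exact h2), by omega⟩
    · rintro ⟨i, hi, rfl, rfl⟩
      rw [h1, h.colLen_eq, h.colLen_self, if_pos rfl]
      omega
  rw [hset, prod_image fun x _ y _ hxy => by simpa using hxy]
  rfl

lemma exists_addsBox {tau : (n - 1).Partition} (hn : 1 ≤ n) (h : cells tau ⊆ cells rho) :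
    ∃ r < n, AddsBox tau rho r := by
  have hle : ∀ i, rowLen tau i ≤ rowLen rho i := by
    intro i
    by_contra! hi
    have := h ((mem_cells_iff tau (s := (i, rowLen rho i))).2 hi)
    rw [mem_cells_iff] at this
    exact lt_irrefl _ this
  have hsum : ∑ i ∈ range n, (rowLen rho i - rowLen tau i) = 1 := by
    rw [sum_tsub_distrib _ fun i _ => hle i, sum_rowLen]
    obtain ⟨m, rfl⟩ : ∃ m, n = m + 1 := ⟨n - 1, by omega⟩
    rw [sum_range_succ, rowLen_eq_zero tau (by omega)]
    have := sum_rowLen tau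
    simp only [Nat.add_sub_cancel] at this
    omega
  obtain ⟨r, hr, hr0⟩ : ∃ r ∈ range n, rowLen rho r - rowLen tau r ≠ 0 := by
    by_contra! hall
    rw [sum_eq_zero hall] at hsum
    omega
  refine ⟨r, mem_range.1 hr, fun i => ?_⟩
  rw [← add_sum_erase _ _ hr] at hsum
  have hrest : ∑ x ∈ (range n).erase r, (rowLen rho x - rowLen tau x) = 0 := by omega
  have := hle i
  split_ifs with hi
  · subst hi
    omega
  · by_cases hin : i < n
    · have := sum_eq_zero_iff.1 hrest i (by simp [hi, hin])
      omega
    · rw [rowLen_eq_zero rho (by omega), rowLen_eq_zero tau (by omega)]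

lemma AddsBox.row_unique {r' : ℕ} (h : AddsBox tau rho r) (h' : AddsBox tau rho r') :
    r = r' := by
  by_contra hne
  have h1 := h r
  have h2 := h' r
  rw [if_pos rfl] at h1
  rw [if_neg hne] at h2
  omega

end AddingABox

section Transitions

/-- The `α`-content of the box which can be added at the end of row `j`. -/
noncomputable def rowNode (α : ℝ) {n : ℕ} (lam : n.Partition) (j : ℕ) : ℝ :=
  α * rowLen lam j - j

lemma rowNode_strictAnti {α : ℝ} (hα : 0 < α) {n : ℕ} (lam : n.Partition) :
    StrictAnti (rowNode α lam) := by
  intro i j hij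
  have h1 : (rowLen lam j : ℝ) ≤ rowLen lam i := by exact_mod_cast rowLen_antitone lam hij.le
  have h2 : (i : ℝ) < j := by exact_mod_cast hij
  unfold rowNode
  nlinarith

lemma nodeWeight_eq_mul (ε : ℝ) (a : ℕ → ℝ) {N i : ℕ} (hi : i < N) :
    nodeWeight ε a N i = (∏ j ∈ range i, (1 + ε / (a i - a j))) *
      ∏ j ∈ Ico (i + 1) N, (1 + ε / (a i - a j)) := by
  rw [nodeWeight, ← prod_union]
  · congr 1
    ext j
    simp
    omega
  · rw [disjoint_left]
    intro j
    simp
    omega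

variable {m n : ℕ} {tau : m.Partition} {rho : n.Partition} {r : ℕ}

lemma AddsBox.rowNode_self (h : AddsBox tau rho r) (α : ℝ) :
    rowNode α rho r = rowNode α tau r + α := by
  rw [rowNode, rowNode, h.rowLen_self]
  push_cast
  ring

lemma AddsBox.rowNode_of_ne (h : AddsBox tau rho r) (α : ℝ) {j : ℕ} (hj : j ≠ r) :
    rowNode α rho j = rowNode α tau j := by
  rw [rowNode, rowNode, h.rowLen_of_ne hj]

lemma AddsBox.prod_boundary (h : AddsBox tau rho r) {α A : ℝ} (hα : 0 < α)
    (hA : 0 < A - rowNode α tau r + 1) :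
    (∏ k ∈ range (rowLen tau r), (A - α * (k + 1) + colLen tau k) / (A - α * k + colLen tau k)) *
      ∏ j ∈ Ico (r + 1) n, (A - rowNode α tau j) / (A - rowNode α tau j + 1) =
      (A - rowNode α tau r + 1) / (A + n) := by
  have key := JackTest.prod_boundary (fun i j => lt_rowLen_iff tau (i := i) (j := j)) (A := A) hα
    (c := rowLen tau r) (r := r) (N := n) (fun j hj => rowLen_antitone tau hj.le)
    (fun k hk => (lt_rowLen_iff tau).1 hk)
    (by unfold rowNode at hA; linarith) h.row_lt
  have hmin : ∀ k, min (colLen tau k) n = colLen tau k := by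
    intro k
    have h1 := h.colLen_eq k
    have h2 := colLen_le rho k
    omega
  simp only [hmin] at key
  unfold rowNode
  convert key using 2
  · refine prod_congr rfl fun j _ => ?_
    congr 1 <;> ring
  · ring

lemma AddsBox.up_weight {tau : (n - 1).Partition} (h : AddsBox tau rho r) {α : ℝ} (hα : 0 < α) :
    cLow α tau * psi' α rho tau / cLow α rho =
      nodeWeight 1 (rowNode α tau) n r / (rowNode α tau r + n) := by
  have hT := prod_boxFactor_pos hα one_pos tau
  have hC : psi' α rho tau = (∏ i ∈ range r, boxFactor α 1 rho (i, rowLen tau r) /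
      boxFactor α 1 tau (i, rowLen tau r)) *
        ∏ j ∈ range r, (1 + 1 / (rowNode α tau r - rowNode α tau j)) := by
    rw [h.psi'_eq, ← prod_mul_distrib]
    refine prod_congr rfl fun i hi => ?_
    rw [mem_range] at hi
    have p1 := boxFactor_pos hα hα rho (i, rowLen tau r)
    have p2 := boxFactor_pos hα one_pos tau (i, rowLen tau r)
    have e1 : rowNode α tau r - rowNode α tau i = -boxFactor α α rho (i, rowLen tau r) := by
      rw [h.boxFactor_new_col hi]
      unfold rowNode
      ring
    have e2 : boxFactor α α tau (i, rowLen tau r) =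
        boxFactor α α rho (i, rowLen tau r) - 1 := by
      rw [h.boxFactor_new_col hi, h.boxFactor_old_col hi]
      ring
    rw [e1, e2]
    field_simp
    ring
  have hR := h.prod_boundary (A := rowNode α tau r) hα (by simp)
  have hR' : ∏ k ∈ range (rowLen tau r), (rowNode α tau r - α * (k + 1) + colLen tau k) /
      (rowNode α tau r - α * k + colLen tau k) =
      (∏ k ∈ range (rowLen tau r), boxFactor α 1 rho (r, k) / boxFactor α 1 tau (r, k))⁻¹ := by
    rw [← prod_inv_distrib]
    refine prod_congr rfl fun k hk => ?_
    rw [mem_range] at hk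
    rw [inv_div, h.boxFactor_new_row hk, AddsBox.boxFactor_old_row hk]
    unfold rowNode
    congr 1 <;> ring
  have hI : (∏ j ∈ Ico (r + 1) n, (1 + 1 / (rowNode α tau r - rowNode α tau j))) *
      ∏ j ∈ Ico (r + 1) n, (rowNode α tau r - rowNode α tau j) /
        (rowNode α tau r - rowNode α tau j + 1) = 1 := by
    rw [← prod_mul_distrib]
    refine prod_eq_one fun j hj => ?_
    rw [mem_Ico] at hj
    have := sub_pos.2 (rowNode_strictAnti hα tau (show r < j by omega))
    field_simp
  rw [hR', sub_self, zero_add] at hR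
  have hCpos : 0 < ∏ i ∈ range r, boxFactor α 1 rho (i, rowLen tau r) /
      boxFactor α 1 tau (i, rowLen tau r) :=
    prod_pos fun i _ => div_pos (boxFactor_pos hα one_pos _ _) (boxFactor_pos hα one_pos _ _)
  have e1 : cLow α tau = ∏ s ∈ cells tau, boxFactor α 1 tau s := rfl
  have e2 : cLow α rho = ∏ s ∈ cells rho, boxFactor α 1 rho s := rfl
  rw [e1, e2, h.prod_boxFactor hα one_pos, hC, nodeWeight_eq_mul _ _ h.row_lt, div_eq_mul_one_div
    (_ * _) (rowNode α tau r + n), ← hR]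
  have hcomm : ∀ X Y R Z : ℝ, X * Y * (R * Z) = X * (Y * Z) * R := fun X Y R Z => by ring
  conv_rhs => rw [hcomm, hI, mul_one, ← div_eq_mul_inv]
  rw [one_mul, ← mul_assoc, mul_comm (∏ k ∈ range (rowLen tau r), _), ← mul_assoc,
    mul_div_mul_left _ _ (mul_pos hT hCpos).ne']

lemma AddsBox.down_weight {tau : (n - 1).Partition} (h : AddsBox tau rho r) {α : ℝ}
    (hα : 0 < α) :
    cUp α rho * psi' α rho tau / cUp α tau =
      nodeWeight (-1) (rowNode α rho) n r * (rowNode α rho r - 1 + n) := by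
  have hT := prod_boxFactor_pos hα hα tau
  have hC : (∏ i ∈ range r, boxFactor α α rho (i, rowLen tau r) /
      boxFactor α α tau (i, rowLen tau r)) * psi' α rho tau =
        ∏ j ∈ range r, (1 + -1 / (rowNode α rho r - rowNode α rho j)) := by
    rw [h.psi'_eq, ← prod_mul_distrib]
    refine prod_congr rfl fun i hi => ?_
    rw [mem_range] at hi
    have p1 := boxFactor_pos hα hα rho (i, rowLen tau r)
    have p2 := boxFactor_pos hα hα tau (i, rowLen tau r)
    have p3 := boxFactor_pos hα one_pos tau (i, rowLen tau r)
    have e1 : rowNode α rho r - rowNode α rho i = -boxFactor α 1 tau (i, rowLen tau r) := by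
      rw [h.boxFactor_old_col hi, h.rowNode_self, h.rowNode_of_ne _ hi.ne]
      unfold rowNode
      ring
    have e2 : boxFactor α 1 rho (i, rowLen tau r) =
        boxFactor α 1 tau (i, rowLen tau r) + 1 := by
      rw [h.boxFactor_new_col hi, h.boxFactor_old_col hi]
      ring
    rw [e1, e2]
    field_simp
  have hR := h.prod_boundary (A := rowNode α rho r - 1) hα (by rw [h.rowNode_self]; linarith)
  have hR' : ∏ k ∈ range (rowLen tau r), (rowNode α rho r - 1 - α * (k + 1) + colLen tau k) /
      (rowNode α rho r - 1 - α * k + colLen tau k) =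
      (∏ k ∈ range (rowLen tau r), boxFactor α α rho (r, k) / boxFactor α α tau (r, k))⁻¹ := by
    rw [← prod_inv_distrib]
    refine prod_congr rfl fun k hk => ?_
    rw [mem_range] at hk
    rw [inv_div, h.boxFactor_new_row hk, AddsBox.boxFactor_old_row hk, h.rowNode_self]
    unfold rowNode
    congr 1 <;> ring
  have hI : ∏ j ∈ Ico (r + 1) n, (rowNode α rho r - 1 - rowNode α tau j) /
        (rowNode α rho r - 1 - rowNode α tau j + 1) =
      ∏ j ∈ Ico (r + 1) n, (1 + -1 / (rowNode α rho r - rowNode α rho j)) := by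
    refine prod_congr rfl fun j hj => ?_
    rw [mem_Ico] at hj
    have := sub_pos.2 (rowNode_strictAnti hα rho (show r < j by omega))
    rw [← h.rowNode_of_ne α (show j ≠ r by omega)]
    have e : rowNode α rho r - 1 - rowNode α rho j + 1 = rowNode α rho r - rowNode α rho j := by
      ring
    rw [e]
    field_simp
    ring
  have hRpos : 0 < ∏ k ∈ range (rowLen tau r),
      boxFactor α α rho (r, k) / boxFactor α α tau (r, k) :=
    prod_pos fun i _ => div_pos (boxFactor_pos hα hα _ _) (boxFactor_pos hα hα _ _)
  have hn : 0 < rowNode α rho r - 1 + n := by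
    have h1 : (r + 1 : ℝ) ≤ n := by exact_mod_cast h.row_lt
    have h2 : 0 ≤ α * rowLen tau r := by positivity
    rw [h.rowNode_self]
    unfold rowNode
    linarith
  rw [hR', hI] at hR
  have e0 : rowNode α rho r - 1 - rowNode α tau r + 1 = α := by
    rw [h.rowNode_self]
    ring
  rw [e0, eq_div_iff hn.ne', inv_mul_eq_div, div_mul_eq_mul_div, div_eq_iff hRpos.ne'] at hR
  have e1 : cUp α tau = ∏ s ∈ cells tau, boxFactor α α tau s := rfl
  have e2 : cUp α rho = ∏ s ∈ cells rho, boxFactor α α rho s := rfl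
  rw [e1, e2, h.prod_boxFactor hα hα, nodeWeight_eq_mul _ _ h.row_lt, mul_assoc (∏ j ∈ range r, _),
    hR, ← hC, div_eq_iff hT.ne']
  ring

end Transitions

section Moments

/-- The numerator of `W`, that is, the sum of the `α`-contents of all boxes. -/
noncomputable def contentSum (α : ℝ) {n : ℕ} (lam : n.Partition) : ℝ :=
  α * nStatConj lam - nStat lam

variable {n : ℕ}

lemma contentSum_eq (α : ℝ) (lam : n.Partition) {N : ℕ} (hN : n ≤ N) :
    contentSum α lam = ∑ i ∈ range N, (α * ((rowLen lam i).choose 2 : ℕ) - i * rowLen lam i) := by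
  rw [contentSum, nStatConj_eq, nStat]
  push_cast
  rw [mul_sum, ← sum_sub_distrib]
  refine sum_subset (range_subset_range.2 hN) fun i _ hi => ?_
  rw [mem_range] at hi
  simp [rowLen_eq_zero lam (by omega : n ≤ i)]

lemma AddsBox.contentSum_eq {tau : (n - 1).Partition} {rho : n.Partition} {r : ℕ}
    (h : AddsBox tau rho r) (α : ℝ) : contentSum α rho = contentSum α tau + rowNode α tau r := by
  rw [JackTest.contentSum_eq α rho le_rfl, JackTest.contentSum_eq α tau (Nat.sub_le n 1),
    ← add_sum_erase _ _ (mem_range.2 h.row_lt), ← add_sum_erase _ _ (mem_range.2 h.row_lt),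
    h.rowLen_self, Nat.choose_succ_succ' (rowLen tau r) 1, Nat.choose_one_right]
  have : ∑ x ∈ (range n).erase r, (α * ((rowLen rho x).choose 2 : ℕ) - x * rowLen rho x) =
      ∑ x ∈ (range n).erase r, (α * ((rowLen tau x).choose 2 : ℕ) - x * rowLen tau x) :=
    sum_congr rfl fun x hx => by rw [h.rowLen_of_ne (ne_of_mem_erase hx)]
  rw [this]
  unfold rowNode
  push_cast
  ring

lemma sum_ite_addsBox {tau : (n - 1).Partition} {rho : n.Partition} {r : ℕ}
    (h : AddsBox tau rho r) (f : ℕ → ℝ) [∀ i, Decidable (AddsBox tau rho i)] :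
    ∑ i ∈ range n, (if AddsBox tau rho i then f i else 0) = f r := by
  rw [sum_eq_single_of_mem r (mem_range.2 h.row_lt) fun i _ hi =>
    if_neg fun h' => hi (h'.row_unique h), if_pos h]

lemma AddsBox.psi'_eq_zero {tau : (n - 1).Partition} {rho : n.Partition} (hn : 1 ≤ n) (α : ℝ)
    (h : ∀ r, ¬ AddsBox tau rho r) : psi' α rho tau = 0 := by
  rw [psi', if_neg]
  intro hsub
  obtain ⟨r, -, hr⟩ := exists_addsBox hn hsub
  exact h r hr

lemma exists_addsBox_or_nodeWeight_eq_zero {α : ℝ} (hn : 1 ≤ n) (tau : (n - 1).Partition) {r : ℕ}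
    (hr : r < n) :
    (∃ rho : n.Partition, AddsBox tau rho r) ∨ nodeWeight 1 (rowNode α tau) n r = 0 := by
  by_cases hadd : r = 0 ∨ rowLen tau r < rowLen tau (r - 1)
  · left
    refine exists_partition_of_rows (N := n) (f := fun i => rowLen tau i + if i = r then 1 else 0)
      (antitone_nat_of_succ_le fun i => ?_) (fun i hi => ?_) ?_
    · have h1 := rowLen_antitone tau (show i ≤ i + 1 by omega)
      rcases hadd with rfl | hadd
      · rw [if_neg (by omega)]
        omega
      · split_ifs with h2 h3 h3
        · omega
        · subst h2
          simpa using hadd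
        · omega
        · omega
    · rw [rowLen_eq_zero tau (by omega), if_neg (by omega)]
    · rw [sum_add_distrib, sum_ite_eq', if_pos (mem_range.2 hr)]
      obtain ⟨m, rfl⟩ : ∃ m, n = m + 1 := ⟨n - 1, by omega⟩
      rw [sum_range_succ, rowLen_eq_zero tau (by omega)]
      have := sum_rowLen tau
      simp only [Nat.add_sub_cancel] at this
      omega
  · right
    push Not at hadd
    obtain ⟨i, rfl⟩ : ∃ i, r = i + 1 := ⟨r - 1, by omega⟩
    have h1 := rowLen_antitone tau (show i ≤ i + 1 by omega)
    have h2 : rowLen tau (i + 1) = rowLen tau i := le_antisymm h1 hadd.2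
    refine prod_eq_zero (i := i) (by simp; omega) ?_
    have e : rowNode α tau (i + 1) - rowNode α tau i = -1 := by
      rw [rowNode, rowNode, h2]
      push_cast
      ring
    rw [e]
    norm_num

lemma exists_addsBox_or_downWeight_eq_zero {α : ℝ} (hn : 1 ≤ n) (rho : n.Partition) {r : ℕ}
    (hr : r < n) :
    (∃ tau : (n - 1).Partition, AddsBox tau rho r) ∨
      nodeWeight (-1) (rowNode α rho) n r * (rowNode α rho r - 1 + n) = 0 := by
  rcases (rowLen_antitone rho (show r ≤ r + 1 by omega)).lt_or_eq with hlt | heq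
  · left
    have hsum : ∑ i ∈ range n, (rowLen rho i - if i = r then 1 else 0) = n - 1 := by
      rw [sum_tsub_distrib, sum_rowLen, sum_ite_eq', if_pos (mem_range.2 hr)]
      intro i _
      split_ifs with h
      · subst h
        omega
      · omega
    obtain ⟨tau, htau⟩ := exists_partition_of_rows (N := n)
      (f := fun i => rowLen rho i - if i = r then 1 else 0)
      (antitone_nat_of_succ_le fun i => by
        have h1 := rowLen_antitone rho (show i ≤ i + 1 by omega)
        split_ifs with h2 h3 h3
        · omega
        · omega
        · subst h3
          omega
        · omega)
      (fun i hi => by rw [rowLen_eq_zero rho hi, Nat.zero_sub]) hsum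
    refine ⟨tau, fun i => ?_⟩
    rw [htau]
    split_ifs with h
    · subst h
      omega
    · omega
  · right
    by_cases hr' : r + 1 < n
    · refine mul_eq_zero_of_left (prod_eq_zero (i := r + 1) (by simp; omega) ?_) _
      have e : rowNode α rho r - rowNode α rho (r + 1) = 1 := by
        rw [rowNode, rowNode, heq]
        push_cast
        ring
      rw [e]
      norm_num
    · obtain rfl : n = r + 1 := by omega
      rw [rowLen_eq_zero rho le_rfl] at heq
      refine mul_eq_zero_of_right _ ?_
      rw [rowNode, ← heq]
      push_cast
      ring

lemma sum_up_weight {α : ℝ} (hα : 0 < α) (hn : 1 ≤ n) (tau : (n - 1).Partition) :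
    ∑ r ∈ range n, nodeWeight 1 (rowNode α tau) n r / (rowNode α tau r + n) = 1 := by
  have hne : ∀ j < n, (-n : ℝ) ≠ rowNode α tau j := by
    intro j hj h
    have h1 : (j : ℝ) < n := by exact_mod_cast hj
    have h2 : 0 ≤ α * rowLen tau j := by positivity
    unfold rowNode at h
    linarith
  have key := prod_one_add_div 1 (rowNode_strictAnti hα tau).injective n hne
  rw [prod_eq_zero (i := n - 1) (by simp; omega)] at key
  · have : ∀ r ∈ range n, nodeWeight 1 (rowNode α tau) n r / (rowNode α tau r + n) =
        -(1 * nodeWeight 1 (rowNode α tau) n r / (-n - rowNode α tau r)) := by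
      intro r _
      rw [one_mul, ← div_neg]
      congr 1
      ring
    rw [sum_congr rfl this, sum_neg_distrib]
    linarith
  · rw [rowNode, rowLen_eq_zero tau le_rfl, Nat.cast_sub hn]
    have e : (-n : ℝ) - (α * (0 : ℕ) - (n - (1 : ℕ))) = -1 := by
      push_cast
      ring
    rw [e]
    norm_num

lemma sum_up_weight_mul {α : ℝ} (hα : 0 < α) (hn : 1 ≤ n) (tau : (n - 1).Partition) :
    ∑ r ∈ range n, nodeWeight 1 (rowNode α tau) n r / (rowNode α tau r + n) * rowNode α tau r =
      0 := by
  have : ∀ r ∈ range n, nodeWeight 1 (rowNode α tau) n r / (rowNode α tau r + n) *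
      rowNode α tau r = nodeWeight 1 (rowNode α tau) n r -
        n * (nodeWeight 1 (rowNode α tau) n r / (rowNode α tau r + n)) := by
    intro r hr
    have h1 : (r : ℝ) < n := by exact_mod_cast mem_range.1 hr
    have h2 : 0 ≤ α * rowLen tau r := by positivity
    have h3 : 0 < rowNode α tau r + n := by
      unfold rowNode
      linarith
    field_simp
    ring
  rw [sum_congr rfl this, sum_sub_distrib, ← mul_sum, sum_up_weight hα hn,
    sum_nodeWeight 1 (rowNode_strictAnti hα tau).injective]
  ring

lemma sum_nodeWeight_mul_rowNode {α : ℝ} (hα : 0 < α) (lam : n.Partition) (N : ℕ) :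
    ∑ r ∈ range N, nodeWeight (-1) (rowNode α lam) N r * rowNode α lam r =
      α * ∑ r ∈ range N, (rowLen lam r : ℝ) - N * (N - 1) := by
  induction N with
  | zero => simp
  | succ N ih =>
    rw [sum_nodeWeight_mul_succ _ (rowNode_strictAnti hα lam).injective, ih, sum_range_succ]
    unfold rowNode
    push_cast
    ring

lemma sum_nodeWeight_mul_rowNode_sq {α : ℝ} (hα : 0 < α) (lam : n.Partition) (N : ℕ) :
    ∑ r ∈ range N, nodeWeight (-1) (rowNode α lam) N r * rowNode α lam r ^ 2 +
        (N - 1) * ∑ r ∈ range N, nodeWeight (-1) (rowNode α lam) N r * rowNode α lam r =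
      ∑ r ∈ range N, (α ^ 2 * (rowLen lam r : ℝ) ^ 2 - 2 * α * (r * rowLen lam r)) := by
  induction N with
  | zero => simp
  | succ N ih =>
    have hinj := (rowNode_strictAnti hα lam).injective
    rw [sum_nodeWeight_mul_sq_succ _ hinj, sum_nodeWeight_mul_succ _ hinj, sum_range_succ, ← ih]
    unfold rowNode
    push_cast
    ring

lemma sum_down_weight {α : ℝ} (hα : 0 < α) (lam : n.Partition) :
    ∑ r ∈ range n, nodeWeight (-1) (rowNode α lam) n r * (rowNode α lam r - 1 + n) = α * n := by
  have hsum : ∑ r ∈ range n, (rowLen lam r : ℝ) = n := by exact_mod_cast sum_rowLen lam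
  have h0 := sum_nodeWeight (-1) (rowNode_strictAnti hα lam).injective n
  have h1 := sum_nodeWeight_mul_rowNode hα lam n
  rw [hsum] at h1
  simp only [add_comm_sub, mul_add, sum_add_distrib, h1, ← sum_mul, h0]
  ring

lemma sum_down_weight_mul {α : ℝ} (hα : 0 < α) (lam : n.Partition) :
    ∑ r ∈ range n, nodeWeight (-1) (rowNode α lam) n r * (rowNode α lam r - 1 + n) *
      rowNode α lam r = 2 * α * contentSum α lam + α ^ 2 * n := by
  have hsum : ∑ r ∈ range n, (rowLen lam r : ℝ) = n := by exact_mod_cast sum_rowLen lam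
  have key := sum_nodeWeight_mul_rowNode_sq hα lam n
  have hα2 : α ^ 2 * n = ∑ r ∈ range n, α ^ 2 * (rowLen lam r : ℝ) := by
    rw [← mul_sum, hsum]
  rw [contentSum_eq α lam le_rfl, hα2]
  rw [mul_sum, ← sum_add_distrib] at key
  rw [mul_sum, ← sum_add_distrib]
  refine Eq.trans (sum_congr rfl fun r _ => ?_) (key.trans (sum_congr rfl fun r _ => ?_))
  · ring
  · rw [Nat.cast_choose_two]
    ring

open Classical in
lemma sum_up {α : ℝ} (hα : 0 < α) (hn : 1 ≤ n) (tau : (n - 1).Partition) :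
    ∑ rho : n.Partition, cLow α tau * psi' α rho tau / cLow α rho * contentSum α rho =
      contentSum α tau := by
  have h1 : ∀ rho : n.Partition,
      cLow α tau * psi' α rho tau / cLow α rho * contentSum α rho =
        ∑ r ∈ range n, if AddsBox tau rho r then
          nodeWeight 1 (rowNode α tau) n r / (rowNode α tau r + n) *
            (contentSum α tau + rowNode α tau r) else 0 := by
    intro rho
    by_cases h : ∃ r, AddsBox tau rho r
    · obtain ⟨r, h⟩ := h
      rw [sum_ite_addsBox h, h.up_weight hα, h.contentSum_eq]
    · push Not at h
      rw [AddsBox.psi'_eq_zero hn α h]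
      simp [h]
  have h2 : ∀ r ∈ range n, (∑ rho : n.Partition, if AddsBox tau rho r then
      nodeWeight 1 (rowNode α tau) n r / (rowNode α tau r + n) *
        (contentSum α tau + rowNode α tau r) else 0) =
      nodeWeight 1 (rowNode α tau) n r / (rowNode α tau r + n) *
        (contentSum α tau + rowNode α tau r) := by
    intro r hr
    rcases exists_addsBox_or_nodeWeight_eq_zero (α := α) hn tau (mem_range.1 hr) with
      ⟨rho, hrho⟩ | h0
    · rw [sum_eq_single_of_mem rho (mem_univ _) fun mu _ hmu => if_neg fun h =>
        hmu (rowLen_injective fun i => by rw [h i, hrho i]), if_pos hrho]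
    · simp [h0]
  rw [sum_congr rfl fun rho _ => h1 rho, sum_comm, sum_congr rfl h2]
  simp only [mul_add, sum_add_distrib]
  rw [← sum_mul, sum_up_weight hα hn, sum_up_weight_mul hα hn]
  ring

open Classical in
lemma sum_down {α : ℝ} (hα : 0 < α) (hn : 1 ≤ n) (lam : n.Partition) :
    ∑ tau : (n - 1).Partition, cUp α lam * psi' α lam tau / cUp α tau * contentSum α tau =
      α * (n - 2) * contentSum α lam := by
  have h1 : ∀ tau : (n - 1).Partition,
      cUp α lam * psi' α lam tau / cUp α tau * contentSum α tau =
        ∑ r ∈ range n, if AddsBox tau lam r then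
          nodeWeight (-1) (rowNode α lam) n r * (rowNode α lam r - 1 + n) *
            (contentSum α lam + α - rowNode α lam r) else 0 := by
    intro tau
    by_cases h : ∃ r, AddsBox tau lam r
    · obtain ⟨r, h⟩ := h
      rw [sum_ite_addsBox h, h.down_weight hα, h.contentSum_eq, h.rowNode_self]
      ring
    · push Not at h
      rw [AddsBox.psi'_eq_zero hn α h]
      simp [h]
  have h2 : ∀ r ∈ range n, (∑ tau : (n - 1).Partition, if AddsBox tau lam r then
      nodeWeight (-1) (rowNode α lam) n r * (rowNode α lam r - 1 + n) *
        (contentSum α lam + α - rowNode α lam r) else 0) =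
      nodeWeight (-1) (rowNode α lam) n r * (rowNode α lam r - 1 + n) *
        (contentSum α lam + α - rowNode α lam r) := by
    intro r hr
    rcases exists_addsBox_or_downWeight_eq_zero (α := α) hn lam (mem_range.1 hr) with
      ⟨tau, htau⟩ | h0
    · rw [sum_eq_single_of_mem tau (mem_univ _) fun mu _ hmu => if_neg fun h =>
        hmu (rowLen_injective fun i => by
          have e1 := h i
          have e2 := htau i
          omega), if_pos htau]
    · simp [h0]
  rw [sum_congr rfl fun tau _ => h1 tau, sum_comm, sum_congr rfl h2]
  simp only [mul_sub _ (_ + _), sum_sub_distrib]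
  rw [← sum_mul, sum_down_weight hα, sum_down_weight_mul hα]
  ring

end Moments

/-- `W_α` is an eigenvector of the chain `M_α` with eigenvalue `1 - 2/n`. -/
theorem W_eigenvector_of_M (α : ℝ) (hα : 1 ≤ α) (n : ℕ) (hn : 2 ≤ n) (lam : n.Partition) :
    (∑ rho : n.Partition, M α lam rho * W α rho) = (1 - 2 / n) * W α lam := by
  have hα0 : 0 < α := by linarith
  have hn0 : (n : ℝ) ≠ 0 := by positivity
  have hM : ∀ rho : n.Partition, M α lam rho * W α rho =
      ∑ tau : (n - 1).Partition, (α * n * √(α * n.choose 2))⁻¹ *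
        (cUp α lam * psi' α lam tau / cUp α tau) *
          (cLow α tau * psi' α rho tau / cLow α rho * contentSum α rho) := by
    intro rho
    rw [M, mul_sum, sum_mul]
    refine sum_congr rfl fun tau _ => ?_
    simp only [W, contentSum, div_eq_mul_inv, mul_inv]
    ring
  rw [sum_congr rfl fun rho _ => hM rho, sum_comm]
  simp only [← mul_sum, sum_up hα0 (by omega : 1 ≤ n), mul_assoc _ (_ / _) _]
  rw [sum_down hα0 (by omega)]
  change _ = _ * (contentSum α lam / √(α * n.choose 2))
  rw [mul_inv, div_eq_mul_inv]
  field_simp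

end JackTest
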